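/- arXiv:1701.01379 — 2 statements merged into one kernel-verified Lean document; each statement's English description precedes it below -/
import Mathlib

section
/- For every ε > 0 there exists q₀ such that for every integer q ≥ q₀ and every finite projective plane Π_q of order q, there exists a saturating set S of Π_q with |S| ≤ (√3 + ε)·√(q·ln q). -/
/-- A finite projective plane of order `q`: any two distinct points lie on a
unique line, any two distinct lines meet in a unique point, there is a
nondegenerate quadrilateral, every line has `q+1` points, every point lies on
`q+1` lines, and there are `q^2+q+1` points and `q^2+q+1` lines. -/
structure ProjPlane (Point Line : Type*) (q : ℕ) where
  Incid : Point → Line → Prop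
  exists_unique_line : ∀ ⦃p p' : Point⦄, p ≠ p' →
    ∃! l : Line, Incid p l ∧ Incid p' l
  exists_unique_point : ∀ ⦃l l' : Line⦄, l ≠ l' →
    ∃! p : Point, Incid p l ∧ Incid p l'
  nondegenerate : ∃ a b c d : Point,
    a ≠ b ∧ a ≠ c ∧ a ≠ d ∧ b ≠ c ∧ b ≠ d ∧ c ≠ d ∧
    ∀ l : Line,
      ¬(Incid a l ∧ Incid b l ∧ Incid c l) ∧
      ¬(Incid a l ∧ Incid b l ∧ Incid d l) ∧
      ¬(Incid a l ∧ Incid c l ∧ Incid d l) ∧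
      ¬(Incid b l ∧ Incid c l ∧ Incid d l)
  card_line_points : ∀ l : Line, Nat.card {p : Point // Incid p l} = q + 1
  card_point_lines : ∀ p : Point, Nat.card {l : Line // Incid p l} = q + 1
  card_points : Nat.card Point = q ^ 2 + q + 1
  card_lines : Nat.card Line = q ^ 2 + q + 1

/-- A point `x` is saturated by a point set `S` if `x ∈ S` or some line
contains `x` and two distinct points of `S`. -/
def ProjPlane.Saturated {Point Line : Type*} {q : ℕ}
    (PP : ProjPlane Point Line q) (S : Set Point) (x : Point) : Prop :=
  x ∈ S ∨ ∃ l : Line, PP.Incid x l ∧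
    ∃ a ∈ S, ∃ b ∈ S, a ≠ b ∧ PP.Incid a l ∧ PP.Incid b l

/-- A set of points is a saturating set if every point of the plane is
saturated by it. -/
def ProjPlane.SaturatingSet {Point Line : Type*} {q : ℕ}
    (PP : ProjPlane Point Line q) (S : Set Point) : Prop :=
  ∀ x : Point, PP.Saturated S x

namespace ProjPlane

variable {Point Line : Type*} {q : ℕ} (PP : ProjPlane Point Line q)

lemma Saturated.mono {PP : ProjPlane Point Line q} {S T : Set Point} (hST : S ⊆ T) {x : Point}
    (h : PP.Saturated S x) : PP.Saturated T x := by
  rcases h with h | ⟨l, hx, a, ha, b, hb, hab, hal, hbl⟩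
  · exact Or.inl (hST h)
  · exact Or.inr ⟨l, hx, a, hST ha, b, hST hb, hab, hal, hbl⟩

lemma eq_line {p p' : Point} (h : p ≠ p') {l l' : Line} (hp : PP.Incid p l) (hp' : PP.Incid p' l)
    (hq : PP.Incid p l') (hq' : PP.Incid p' l') : l = l' :=
  (PP.exists_unique_line h).unique ⟨hp, hp'⟩ ⟨hq, hq'⟩

variable [Fintype Point]

open scoped Classical in
/-- The points not saturated by `A`. -/
noncomputable def unsaturated (A : Finset Point) : Finset Point :=
  {x | ¬ PP.Saturated (A : Set Point) x}

lemma mem_unsaturated {A : Finset Point} {x : Point} :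
    x ∈ PP.unsaturated A ↔ ¬ PP.Saturated (A : Set Point) x := by
  simp [unsaturated]

open scoped Classical in
lemma card_mul_le_card_saturating {A : Finset Point} {x : Point} (hx : x ∈ PP.unsaturated A) :
    A.card * (q - 1) ≤
      (Finset.univ.filter fun y => y ∉ A ∧ PP.Saturated (insert y (A : Set Point)) x).card := by
  rw [mem_unsaturated, Saturated, not_or] at hx
  obtain ⟨hxA, hx⟩ := hx
  push Not at hx
  have hline : ∀ a : Point, ∃ l : Line, a ≠ x → PP.Incid x l ∧ PP.Incid a l := by
    intro a
    by_cases h : a = x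
    · obtain ⟨b, hb⟩ : ∃ b, b ≠ x := by
        obtain ⟨a, b, -, -, hab, -⟩ := PP.nondegenerate
        by_cases h : a = x
        · exact ⟨b, fun hb => hab (h.trans hb.symm)⟩
        · exact ⟨a, h⟩
      exact ⟨(PP.exists_unique_line hb).choose, fun h' => absurd h h'⟩
    · obtain ⟨l, hl, -⟩ := PP.exists_unique_line (Ne.symm h)
      exact ⟨l, fun _ => hl⟩
  choose L hL using hline
  have hne : ∀ a ∈ A, a ≠ x := fun a ha h => hxA (by simpa [← h] using ha)
  let T : Point → Finset Point := fun a =>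
    ((Finset.univ.filter fun y => PP.Incid y (L a)).erase a).erase x
  have hT : ∀ a ∈ A, (T a).card = q - 1 := by
    intro a ha
    obtain ⟨h1, h2⟩ := hL a (hne a ha)
    have hc := PP.card_line_points (L a)
    rw [Nat.card_eq_fintype_card, Fintype.card_subtype] at hc
    rw [Finset.card_erase_of_mem, Finset.card_erase_of_mem, hc]
    · omega
    · simpa using h2
    · simpa [(hne a ha).symm] using h1
  have hdisj : (A : Set Point).PairwiseDisjoint T := by
    intro a ha b hb hab
    rw [Function.onFun, Finset.disjoint_left]
    intro y hya hyb
    simp only [T, Finset.mem_erase, Finset.mem_filter, Finset.mem_univ, true_and] at hya hyb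
    obtain ⟨ha1, ha2⟩ := hL a (hne a ha)
    obtain ⟨hb1, hb2⟩ := hL b (hne b hb)
    have := PP.eq_line hya.1 hya.2.2 ha1 hyb.2.2 hb1
    exact hx (L a) ha1 a ha b hb hab ha2 (this ▸ hb2)
  calc A.card * (q - 1) = (A.biUnion T).card := by
        rw [Finset.card_biUnion hdisj, Finset.sum_congr rfl hT, Finset.sum_const, smul_eq_mul]
    _ ≤ _ := by
        refine Finset.card_le_card fun y hy => ?_
        obtain ⟨a, ha, hy⟩ := Finset.mem_biUnion.1 hy
        simp only [T, Finset.mem_erase, Finset.mem_filter, Finset.mem_univ, true_and] at hy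
        obtain ⟨ha1, ha2⟩ := hL a (hne a ha)
        simp only [Finset.mem_filter, Finset.mem_univ, true_and]
        exact ⟨fun hyA => hx (L a) ha1 a ha y hyA hy.2.1.symm ha2 hy.2.2,
          Or.inr ⟨L a, ha1, a, Or.inr ha, y, Or.inl rfl, hy.2.1.symm, ha2, hy.2.2⟩⟩

open scoped Classical in
lemma exists_insert_unsaturated_card_le {A : Finset Point} (hA : A.card < Fintype.card Point) :
    ∃ y ∉ A, ((PP.unsaturated (insert y A)).card : ℝ) ≤
      (PP.unsaturated A).card * (1 - A.card * ((q - 1 : ℕ) : ℝ) / Fintype.card Point) := by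
  set U := PP.unsaturated A with hU
  set N := Fintype.card Point
  have hN : (0 : ℝ) < N := by exact_mod_cast (Nat.zero_le _).trans_lt hA
  let r : Point → Point → Prop := fun y x => PP.Saturated (insert y (A : Set Point)) x
  have hcount : (U.card : ℝ) * (A.card * ((q - 1 : ℕ) : ℝ)) ≤
      ∑ y ∈ Aᶜ, ((U.filter (r y)).card : ℝ) := by
    have h := Finset.sum_card_bipartiteAbove_eq_sum_card_bipartiteBelow r (s := Aᶜ) (t := U)
    simp only [Finset.bipartiteAbove, Finset.bipartiteBelow] at h
    have h' : U.card * (A.card * (q - 1)) ≤ ∑ y ∈ Aᶜ, (U.filter (r y)).card := by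
      rw [h, ← smul_eq_mul, ← Finset.sum_const]
      refine Finset.sum_le_sum fun x hx => (PP.card_mul_le_card_saturating hx).trans
        (Finset.card_le_card fun y hy => ?_)
      simpa [r] using hy
    exact_mod_cast h'
  have hne : (Aᶜ).Nonempty := by
    rw [← Finset.card_pos, Finset.card_compl]
    omega
  obtain ⟨y, hy, hyle⟩ : ∃ y ∈ Aᶜ,
      (U.card : ℝ) * (A.card * ((q - 1 : ℕ) : ℝ)) / N ≤ ((U.filter (r y)).card : ℝ) := by
    refine Finset.exists_le_of_sum_le hne (le_trans ?_ hcount)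
    rw [Finset.sum_const, nsmul_eq_mul, mul_div_assoc', div_le_iff₀ hN, mul_comm]
    gcongr
    exact Finset.card_le_univ _
  refine ⟨y, Finset.mem_compl.1 hy, ?_⟩
  have hsub : PP.unsaturated (insert y A) ⊆ U.filter fun x => ¬ r y x := by
    intro x hx
    rw [mem_unsaturated, Finset.coe_insert] at hx
    rw [Finset.mem_filter, hU, mem_unsaturated]
    exact ⟨fun h => hx (h.mono (Set.subset_insert _ _)), hx⟩
  have h1 : ((PP.unsaturated (insert y A)).card : ℝ) ≤ (U.filter fun x => ¬ r y x).card := by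
    exact_mod_cast Finset.card_le_card hsub
  have h2 : ((U.filter (r y)).card : ℝ) + (U.filter fun x => ¬ r y x).card = U.card := by
    exact_mod_cast Finset.card_filter_add_card_filter_not (s := U) (r y)
  have h3 : (U.card : ℝ) * (1 - A.card * ((q - 1 : ℕ) : ℝ) / N) =
      U.card - (U.card : ℝ) * (A.card * ((q - 1 : ℕ) : ℝ)) / N := by ring
  linarith

lemma exists_card_eq_unsaturated_card_le (k : ℕ) (hk : k ≤ Fintype.card Point) :
    ∃ A : Finset Point, A.card = k ∧ ((PP.unsaturated A).card : ℝ) ≤ Fintype.card Point *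
      Real.exp (-(((q - 1 : ℕ) : ℝ) / Fintype.card Point * (k * (k - 1) / 2))) := by
  classical
  induction k with
  | zero => exact ⟨∅, rfl, by simpa using Finset.card_le_univ _⟩
  | succ k ih =>
    obtain ⟨A, hA, hle⟩ := ih (by omega)
    obtain ⟨y, hy, hyle⟩ := PP.exists_insert_unsaturated_card_le (A := A) (by omega)
    refine ⟨insert y A, by rw [Finset.card_insert_of_notMem hy, hA], hyle.trans ?_⟩
    rw [hA]
    calc _ ≤ ((PP.unsaturated A).card : ℝ) *
          Real.exp (-(k * ((q - 1 : ℕ) : ℝ) / Fintype.card Point)) := by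
          gcongr
          exact Real.one_sub_le_exp_neg _
      _ ≤ _ := mul_le_mul_of_nonneg_right hle (Real.exp_pos _).le
      _ = _ := by
          rw [mul_assoc, ← Real.exp_add]
          congr 2
          push_cast
          ring

lemma exists_saturatingSet_ncard_le (k : ℕ) (hk : k ≤ Fintype.card Point) :
    ∃ S : Set Point, PP.SaturatingSet S ∧ (S.ncard : ℝ) ≤ k + Fintype.card Point *
      Real.exp (-(((q - 1 : ℕ) : ℝ) / Fintype.card Point * (k * (k - 1) / 2))) := by
  classical
  obtain ⟨A, rfl, hle⟩ := PP.exists_card_eq_unsaturated_card_le k hk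
  refine ⟨((A ∪ PP.unsaturated A : Finset Point) : Set Point), fun x => ?_, ?_⟩
  · by_cases h : PP.Saturated (A : Set Point) x
    · exact h.mono (by simp)
    · exact Or.inl (by simp [mem_unsaturated, h])
  · rw [Set.ncard_coe_finset]
    have : ((A ∪ PP.unsaturated A).card : ℝ) ≤ A.card + (PP.unsaturated A).card := by
      exact_mod_cast Finset.card_union_le _ _
    linarith

end ProjPlane

lemma card_mul_exp_neg_le {q : ℕ} (hq : 1 ≤ q) {t : ℝ} (ht : 3 * (q * Real.log q) ≤ t) :
    ((q ^ 2 + q + 1 : ℕ) : ℝ) *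
      Real.exp (-(((q - 1 : ℕ) : ℝ) / ((q ^ 2 + q + 1 : ℕ) : ℝ) * (t / 2))) ≤
      3 * Real.exp 3 * Real.sqrt q := by
  have hq1 : (1 : ℝ) ≤ q := by exact_mod_cast hq
  have hq0 : (0 : ℝ) < q := by linarith
  have hlog0 : 0 ≤ Real.log q := Real.log_nonneg hq1
  have hlog : Real.log q ≤ q := (Real.log_le_sub_one_of_pos hq0).trans (by linarith)
  rw [Nat.cast_sub hq]
  push_cast
  have hN : (0 : ℝ) < (q : ℝ) ^ 2 + q + 1 := by positivity
  have hexp : 3 / 2 * Real.log q - 3 ≤ ((q : ℝ) - 1) / ((q : ℝ) ^ 2 + q + 1) * (t / 2) := by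
    calc 3 / 2 * Real.log q - 3
        ≤ ((q : ℝ) - 1) / ((q : ℝ) ^ 2 + q + 1) * (3 * (q * Real.log q) / 2) := by
          rw [div_mul_eq_mul_div ((q : ℝ) - 1), le_div_iff₀ hN]
          nlinarith [mul_nonneg hlog0 hq0.le, mul_le_mul_of_nonneg_left hlog hq0.le]
      _ ≤ _ := by
          have : 0 ≤ (q : ℝ) - 1 := by linarith
          gcongr
  have hpow : Real.exp (-(3 / 2 * Real.log q)) * (q : ℝ) ^ 2 = Real.sqrt q := by
    rw [Real.sqrt_eq_rpow, ← Real.rpow_natCast, Real.rpow_def_of_pos hq0, Real.rpow_def_of_pos hq0,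
      ← Real.exp_add]
    congr 1
    push_cast
    ring
  calc _ ≤ (3 * (q : ℝ) ^ 2) * Real.exp (-(3 / 2 * Real.log q - 3)) := by
        gcongr
        nlinarith
    _ = 3 * Real.exp 3 * (Real.exp (-(3 / 2 * Real.log q)) * (q : ℝ) ^ 2) := by
        rw [show -(3 / 2 * Real.log (q : ℝ) - 3) = -(3 / 2 * Real.log q) + 3 by ring, Real.exp_add]
        ring
    _ = _ := by rw [hpow]

/-- For every ε > 0, for all sufficiently large q, every finite projective
plane of order q has a saturating set of size at most (√3 + ε)·√(q·ln q). -/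
theorem exists_saturating_set_asymptotic (ε : ℝ) (hε : 0 < ε) :
    ∃ q₀ : ℕ, ∀ q : ℕ, q₀ ≤ q →
      ∀ (Point Line : Type) (PP : ProjPlane Point Line q),
        ∃ S : Set Point, PP.SaturatingSet S ∧
          (S.ncard : ℝ) ≤ (Real.sqrt 3 + ε) * Real.sqrt (q * Real.log q) := by
  have hlim : Filter.Tendsto (fun q : ℕ => ε * Real.sqrt (Real.log q)) Filter.atTop
      Filter.atTop :=
    (Real.tendsto_sqrt_atTop.comp
      (Real.tendsto_log_atTop.comp tendsto_natCast_atTop_atTop)).const_mul_atTop hε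
  obtain ⟨q₁, hq₁⟩ := Filter.eventually_atTop.1
    (hlim.eventually_ge_atTop (2 + 3 * Real.exp 3))
  refine ⟨max q₁ 3, fun q hq Point Line PP => ?_⟩
  have hqε := hq₁ q ((le_max_left _ _).trans hq)
  have hq3 : 3 ≤ q := (le_max_right _ _).trans hq
  have hq3' : (3 : ℝ) ≤ q := by exact_mod_cast hq3
  have hq0 : (0 : ℝ) < q := by linarith
  have hlog0 : 0 ≤ Real.log q := Real.log_nonneg (by linarith)
  have hlog : Real.log q ≤ q := (Real.log_le_sub_one_of_pos hq0).trans (by linarith)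
  have : Finite Point := Nat.finite_of_card_ne_zero (by rw [PP.card_points]; omega)
  have := Fintype.ofFinite Point
  have hcard : Fintype.card Point = q ^ 2 + q + 1 := by
    rw [← Nat.card_eq_fintype_card, PP.card_points]
  set m := ⌈Real.sqrt (3 * (q * Real.log q))⌉₊ with hm
  have hm1 : Real.sqrt (3 * (q * Real.log q)) ≤ m := Nat.le_ceil _
  have hm2 : (m : ℝ) < Real.sqrt (3 * (q * Real.log q)) + 1 :=
    Nat.ceil_lt_add_one (Real.sqrt_nonneg _)
  have hmq : m ≤ 2 * q := by
    refine Nat.ceil_le.2 (Real.sqrt_le_iff.2 ⟨by positivity, ?_⟩)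
    push_cast
    nlinarith [mul_le_mul_of_nonneg_left hlog hq0.le]
  have hk : m + 1 ≤ Fintype.card Point := by
    rw [hcard]
    nlinarith
  obtain ⟨S, hS, hSle⟩ := PP.exists_saturatingSet_ncard_le (m + 1) hk
  refine ⟨S, hS, hSle.trans ?_⟩
  rw [hcard]
  have ht : 3 * (q * Real.log q) ≤ ((m + 1 : ℕ) : ℝ) * (((m + 1 : ℕ) : ℝ) - 1) := by
    push_cast
    have := (Real.sqrt_le_left (Nat.cast_nonneg m)).1 hm1
    nlinarith [(Nat.cast_nonneg m : (0 : ℝ) ≤ m)]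
  have hU := card_mul_exp_neg_le (by omega) ht
  have hs1 : 1 ≤ Real.sqrt q := Real.one_le_sqrt.2 (by linarith)
  rw [Real.sqrt_mul (by norm_num)] at hm2
  have hfin := mul_le_mul_of_nonneg_right hqε (Real.sqrt_nonneg (q : ℝ))
  have hsplit : Real.sqrt (q * Real.log q) = Real.sqrt q * Real.sqrt (Real.log q) :=
    Real.sqrt_mul hq0.le _
  have hprod : ε * Real.sqrt (Real.log q) * Real.sqrt q = ε * Real.sqrt (q * Real.log q) := by
    rw [hsplit]
    ring
  push_cast at hU ⊢
  linarith
end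

section
/- Let S be a set of i points in a finite projective plane Π_q of order q ≥ 2 with 1 ≤ i ≤ q, and let R be the set of points of Π_q that are not in S and are not saturated by S. Then there exists a point P ∉ S such that, letting R' denote the set of points not in S ∪ {P} and not saturated by S ∪ {P}, one has |R'| ≤ |R|·(1 − i/(q+2)) (as real numbers). -/
theorem ProjPlane.finite_point {Point Line : Type*} {q : ℕ}
    (PP : ProjPlane Point Line q) : Finite Point :=
  Nat.finite_of_card_ne_zero (by rw [PP.card_points]; omega)

/-- An unsaturated point `x` becomes saturated on adding any point, other than those of `S`, of the
`|S|` distinct lines joining `x` to `S`. -/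
theorem ProjPlane.ncard_saturating_ge {Point Line : Type*} {q : ℕ}
    (PP : ProjPlane Point Line q) {S : Set Point} {x : Point} (hx : ¬ PP.Saturated S x) :
    S.ncard * (q - 1) + 1 ≤ {P : Point | P ∉ S ∧ PP.Saturated (S ∪ {P}) x}.ncard := by
  classical
  have := PP.finite_point
  have := Fintype.ofFinite Point
  have hxS : x ∉ S := fun h => hx (Or.inl h)
  have hline : ∀ s, ∃ l : Line, s ∈ S → PP.Incid x l ∧ PP.Incid s l := by
    intro s
    by_cases hs : s ∈ S
    · obtain ⟨l, hl, -⟩ := PP.exists_unique_line (fun h : x = s => hxS (h ▸ hs))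
      exact ⟨l, fun _ => hl⟩
    · obtain ⟨a, b, -, -, hab, -⟩ := PP.nondegenerate
      obtain ⟨l, -⟩ := PP.exists_unique_line hab
      exact ⟨l, fun h => absurd h hs⟩
  choose L hL using hline
  have htangent : ∀ s ∈ S, ∀ p ∈ S, PP.Incid p (L s) → p = s := by
    intro s hs p hp hpl
    by_contra hne
    exact hx (Or.inr ⟨L s, (hL s hs).1, p, hp, s, hs, hne, hpl, (hL s hs).2⟩)
  let A : Point → Finset Point := fun s => ({p | PP.Incid p (L s)} : Finset Point) \ {x, s}
  have hA : ∀ s ∈ S, (A s).card = q - 1 := by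
    intro s hs
    have hsub : ({x, s} : Finset Point) ⊆ ({p | PP.Incid p (L s)} : Finset Point) := by
      intro p hp
      rcases Finset.mem_insert.1 hp with rfl | hp
      · simpa using (hL s hs).1
      · simpa [Finset.mem_singleton.1 hp] using (hL s hs).2
    have hcard : ({p | PP.Incid p (L s)} : Finset Point).card = q + 1 := by
      rw [← PP.card_line_points (L s), Nat.card_eq_fintype_card, Fintype.card_subtype]
    simp only [A]
    rw [Finset.card_sdiff_of_subset hsub, hcard,
      Finset.card_pair (fun h : x = s => hxS (h ▸ hs))]
    omega
  have hdisj : (S.toFinset : Set Point).PairwiseDisjoint A := by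
    intro s hs t ht hst
    rw [Set.coe_toFinset] at hs ht
    refine Finset.disjoint_left.2 fun p hps hpt => hst ?_
    simp only [A, Finset.mem_sdiff, Finset.mem_filter, Finset.mem_univ, true_and,
      Finset.mem_insert, Finset.mem_singleton, not_or] at hps hpt
    have hl : L s = L t := (PP.exists_unique_line hps.2.1).unique
      ⟨hps.1, (hL s hs).1⟩ ⟨hpt.1, (hL t ht).1⟩
    exact htangent t ht s hs (hl ▸ (hL s hs).2)
  have hxA : x ∉ S.toFinset.biUnion A := by simp [A]
  have hcard : (insert x (S.toFinset.biUnion A)).card = S.ncard * (q - 1) + 1 := by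
    rw [Finset.card_insert_of_notMem hxA, Finset.card_biUnion hdisj,
      Finset.sum_congr rfl fun s hs => hA s (Set.mem_toFinset.1 hs), Finset.sum_const,
      smul_eq_mul, Set.ncard_eq_toFinset_card']
  rw [← hcard, ← Set.ncard_coe_finset]
  refine Set.ncard_le_ncard (fun p hp => ?_) (Set.toFinite _)
  rcases Finset.mem_insert.1 (Finset.mem_coe.1 hp) with rfl | hp
  · exact ⟨hxS, Or.inl (Or.inr rfl)⟩
  · obtain ⟨s, hs, hp⟩ := Finset.mem_biUnion.1 hp
    rw [Set.mem_toFinset] at hs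
    simp only [A, Finset.mem_sdiff, Finset.mem_filter, Finset.mem_univ, true_and,
      Finset.mem_insert, Finset.mem_singleton, not_or] at hp
    exact ⟨fun hpS => hp.2.2 (htangent s hs p hpS hp.1),
      Or.inr ⟨L s, (hL s hs).1, p, Or.inr rfl, s, Or.inl hs, hp.2.2, hp.1, (hL s hs).2⟩⟩

theorem ProjPlane.Saturated.mono_s10 {Point Line : Type*} {q : ℕ} {PP : ProjPlane Point Line q}
    {S T : Set Point} (hST : S ⊆ T) {x : Point} (h : PP.Saturated S x) : PP.Saturated T x := by
  rcases h with h | ⟨l, hl, a, ha, b, hb, h⟩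
  · exact Or.inl (hST h)
  · exact Or.inr ⟨l, hl, a, hST ha, b, hST hb, h⟩

/-- Greedy step: there is a point P ∉ S whose addition to S decreases the
number of unsaturated points by a factor of at least (1 − i/(q+2)). -/
theorem greedy_step {Point Line : Type*} {q i : ℕ} (hq : 2 ≤ q)
    (PP : ProjPlane Point Line q) (S : Set Point)
    (hScard : S.ncard = i) (hi : 1 ≤ i) (hiq : i ≤ q)
    (R : Set Point) (hR : R = {x : Point | x ∉ S ∧ ¬ PP.Saturated S x}) :
    ∃ P : Point, P ∉ S ∧
      ({x : Point | x ∉ S ∪ {P} ∧ ¬ PP.Saturated (S ∪ {P}) x}.ncard : ℝ)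
        ≤ (R.ncard : ℝ) * (1 - (i : ℝ) / ((q : ℝ) + 2)) := by
  classical
  have := PP.finite_point
  have := Fintype.ofFinite Point
  by_contra! hlt
  let sat : Point → Point → Prop := fun P x => PP.Saturated (S ∪ {P}) x
  have hsplit : ∀ P, ({x : Point | x ∉ S ∪ {P} ∧ ¬ PP.Saturated (S ∪ {P}) x}.ncard : ℝ)
      + (R.toFinset.bipartiteAbove sat P).card = R.ncard := by
    intro P
    have hcompl : {x : Point | x ∉ S ∪ {P} ∧ ¬ PP.Saturated (S ∪ {P}) x}
        = ({x ∈ R.toFinset | ¬ sat P x} : Finset Point) := by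
      ext x
      simp only [hR, sat, Set.mem_ofPred_eq, Finset.coe_filter, Set.mem_toFinset]
      constructor
      · rintro ⟨h1, h2⟩
        exact ⟨⟨fun h => h1 (Or.inl h), fun h => h2 (h.mono_s10 Set.subset_union_left)⟩, h2⟩
      · rintro ⟨-, h2⟩
        exact ⟨fun h => h2 (Or.inl h), h2⟩
    rw [hcompl, Set.ncard_coe_finset, Set.ncard_eq_toFinset_card', add_comm]
    exact_mod_cast Finset.card_filter_add_card_filter_not (s := R.toFinset) (sat P)
  have hq' : (0 : ℝ) < (q : ℝ) + 2 := by positivity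
  have hi1 : (1 : ℝ) ≤ i := by exact_mod_cast hi
  have hiq' : (i : ℝ) ≤ q := by exact_mod_cast hiq
  have hSc : (Sᶜ.toFinset.card : ℝ) = (q : ℝ) ^ 2 + q + 1 - i := by
    have h := Set.ncard_add_ncard_compl S
    rw [hScard, PP.card_points, Set.ncard_eq_toFinset_card' Sᶜ] at h
    have h' : (i : ℝ) + Sᶜ.toFinset.card = (q : ℝ) ^ 2 + q + 1 := by exact_mod_cast h
    linarith
  have hne : Sᶜ.toFinset.Nonempty := by
    rw [← Finset.card_pos, ← Nat.cast_pos (α := ℝ), hSc]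
    nlinarith
  have hupper : ∑ P ∈ Sᶜ.toFinset, ((R.toFinset.bipartiteAbove sat P).card : ℝ)
      < Sᶜ.toFinset.card * (R.ncard * (i / ((q : ℝ) + 2))) := by
    rw [← nsmul_eq_mul, ← Finset.sum_const]
    refine Finset.sum_lt_sum_of_nonempty hne fun P hP => ?_
    have h1 := hlt P (by simpa using hP)
    have h2 := hsplit P
    linarith
  have hlower : (R.ncard : ℝ) * (i * ((q : ℝ) - 1) + 1)
      ≤ ∑ x ∈ R.toFinset, ((Sᶜ.toFinset.bipartiteBelow sat x).card : ℝ) := by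
    rw [Set.ncard_eq_toFinset_card' R, ← nsmul_eq_mul]
    refine Finset.card_nsmul_le_sum _ _ _ fun x hx => ?_
    have hxR : ¬ PP.Saturated S x := by
      rw [Set.mem_toFinset, hR] at hx
      exact hx.2
    have h := PP.ncard_saturating_ge hxR
    have heq : {P : Point | P ∉ S ∧ PP.Saturated (S ∪ {P}) x}
        = (Sᶜ.toFinset.bipartiteBelow sat x : Finset Point) := by
      ext P
      simp [Finset.bipartiteBelow, sat]
    rw [heq, Set.ncard_coe_finset, hScard] at h
    have h' : ((i * (q - 1) + 1 : ℕ) : ℝ) ≤ (Sᶜ.toFinset.bipartiteBelow sat x).card := by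
      exact_mod_cast h
    rwa [Nat.cast_add, Nat.cast_mul, Nat.cast_sub (by omega), Nat.cast_one] at h'
  have hdouble : ∑ P ∈ Sᶜ.toFinset, ((R.toFinset.bipartiteAbove sat P).card : ℝ)
      = ∑ x ∈ R.toFinset, ((Sᶜ.toFinset.bipartiteBelow sat x).card : ℝ) := by
    exact_mod_cast Finset.sum_card_bipartiteAbove_eq_sum_card_bipartiteBelow sat
  have hratio : ((q : ℝ) ^ 2 + q + 1 - i) * (i / ((q : ℝ) + 2)) ≤ i * ((q : ℝ) - 1) + 1 := by
    rw [← mul_div_assoc, div_le_iff₀ hq']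
    nlinarith [sq_nonneg ((i : ℝ) - 1)]
  have hR0 : (0 : ℝ) ≤ R.ncard := Nat.cast_nonneg _
  have := mul_le_mul_of_nonneg_left hratio hR0
  rw [hSc, hdouble] at hupper
  linarith
end
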